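/- Let S ∈ B⁰(H) and let U be any ultrafilter on ℝⁿ × ℝⁿ. Then there exists an operator T_U(S) ∈ B⁰(H) such that, along the ultrafilter U, T_X(S) u converges in norm to T_U(S) u and T_X(S)* u converges in norm to T_U(S)* u for every u ∈ H; i.e., the limit of T_X(S) along U exists in the *-strong operator topology and belongs to B⁰(H). -/

import Mathlib

open MeasureTheory Filter Topology Matrix
open scoped Pointwise

noncomputable section

/-- Phase space `Ξ = ℝⁿ × (ℝⁿ)*`. -/
abbrev Xi (n : ℕ) := (Fin n → ℝ) × (Fin n → ℝ)

/-- The Hilbert space `H = L²(ℝⁿ, ℂ)`. -/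
abbrev Hn (n : ℕ) := Lp ℂ 2 (volume : Measure (Fin n → ℝ))

/-- `W` is the family of operators given by
`(W(x,ξ)u)(y) = exp(i (y - x/2)·ξ) u(y - x)` (almost everywhere). -/
def IsWeylFamily (n : ℕ) (W : Xi n → (Hn n →L[ℂ] Hn n)) : Prop :=
  ∀ (x ξ : Fin n → ℝ) (u : Hn n), ∀ᵐ y ∂(volume : Measure (Fin n → ℝ)),
    W (x, ξ) u y
      = Complex.exp (Complex.I * (((y - (2⁻¹ : ℝ) • x) ⬝ᵥ ξ : ℝ) : ℂ)) * u (y - x)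

/-- Conjugation `T_X(S) := W(X) S W(X)*`. -/
def Tconj (n : ℕ) (W : Xi n → (Hn n →L[ℂ] Hn n)) (X : Xi n)
    (S : Hn n →L[ℂ] Hn n) : Hn n →L[ℂ] Hn n :=
  W X * S * star (W X)

/-- `B⁰(H)`: the set of `S` whose orbit `X ↦ T_X(S)` is norm-continuous. -/
def B0 (n : ℕ) (W : Xi n → (Hn n →L[ℂ] Hn n)) : Set (Hn n →L[ℂ] Hn n) :=
  {S | Continuous fun X : Xi n => Tconj n W X S}

theorem enorm_sq_eq_lintegral {n : ℕ} (f : Hn n) : ‖f‖ₑ ^ 2 = ∫⁻ y, ‖f y‖ₑ ^ 2 := by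
  rw [Lp.enorm_def, eLpNorm_eq_lintegral_rpow_enorm_toReal (by simp) (by simp)]
  rw [← ENNReal.rpow_natCast, ← ENNReal.rpow_mul]
  simp

theorem lintegral_sq_le_measure_mul {α : Type*} [MeasurableSpace α] (μ : Measure α)
    {g : α → ENNReal} (hg : AEMeasurable g μ) :
    (∫⁻ a, g a ∂μ) ^ 2 ≤ μ Set.univ * ∫⁻ a, g a ^ 2 ∂μ := by
  have h := ENNReal.lintegral_mul_le_Lp_mul_Lq μ Real.HolderConjugate.two_two
    (f := fun _ => 1) aemeasurable_const hg
  simp only [Pi.mul_apply, one_mul, ENNReal.one_rpow, lintegral_const] at h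
  calc _ ≤ (μ Set.univ ^ (1 / 2 : ℝ) * (∫⁻ a, g a ^ (2 : ℝ) ∂μ) ^ (1 / 2 : ℝ)) ^ 2 := by gcongr
    _ = _ := by
      rw [mul_pow, ← ENNReal.rpow_natCast, ← ENNReal.rpow_natCast, ← ENNReal.rpow_mul,
        ← ENNReal.rpow_mul]
      simp

theorem enorm_exp_I_mul_sub_one_sq (s : ℝ) :
    ‖Complex.exp (Complex.I * (s : ℂ)) - 1‖ₑ ^ 2 = ENNReal.ofReal (2 - 2 * Real.cos s) := by
  rw [← ofReal_norm, ← ENNReal.ofReal_pow (norm_nonneg _), ← Complex.normSq_eq_norm_sq]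
  congr 1
  rw [mul_comm, Complex.exp_mul_I, ← Complex.ofReal_cos, ← Complex.ofReal_sin, Complex.normSq_apply]
  simp only [Complex.sub_re, Complex.add_re, Complex.mul_re, Complex.sub_im, Complex.add_im,
    Complex.mul_im, Complex.ofReal_re, Complex.ofReal_im, Complex.I_re, Complex.I_im,
    Complex.one_re, Complex.one_im]
  nlinarith [Real.sin_sq_add_cos_sq s]

theorem two_mul_le_lintegral_exp {a δ : ℝ} (hδ : 0 < δ) (ha : 2 / δ ≤ |a|) :
    ENNReal.ofReal (2 * δ) ≤
      ∫⁻ t in Set.Icc (-δ) δ, ‖Complex.exp (Complex.I * ((a * t : ℝ) : ℂ)) - 1‖ₑ ^ 2 := by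
  have ha0 : a ≠ 0 := by
    rintro rfl
    have : 0 < 2 / δ := by positivity
    simp at ha; linarith
  simp_rw [enorm_exp_I_mul_sub_one_sq]
  rw [← ofReal_integral_eq_lintegral_ofReal]
  · apply ENNReal.ofReal_le_ofReal
    rw [integral_Icc_eq_integral_Ioc, ← intervalIntegral.integral_of_le (by linarith)]
    have hd : ∀ x ∈ Set.uIcc (-δ) δ,
        HasDerivAt (fun t => 2 * t - 2 * (Real.sin (a * t) / a)) (2 - 2 * Real.cos (a * x)) x := by
      intro x _
      have h1 := ((((hasDerivAt_id x).const_mul a).sin).div_const a).const_mul 2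
      have h2 := (((hasDerivAt_id x).const_mul 2).sub h1)
      have h3 : 2 - 2 * Real.cos (a * x) = 2 * 1 - 2 * (Real.cos (a * id x) * (a * 1) / a) := by
        simp only [id]
        field_simp
      rw [h3]
      exact h2
    rw [intervalIntegral.integral_eq_sub_of_hasDerivAt hd (by
      apply Continuous.intervalIntegrable; fun_prop)]
    have h3 : |Real.sin (a * δ) / a| ≤ δ / 2 := by
      rw [abs_div, div_le_iff₀ (abs_pos.2 ha0)]
      rw [div_le_iff₀ hδ] at ha
      nlinarith [Real.abs_sin_le_one (a * δ)]
    have h4 := abs_le.1 h3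
    have h5 : Real.sin (a * -δ) = - Real.sin (a * δ) := by rw [mul_neg, Real.sin_neg]
    rw [h5, neg_div]
    linarith [h4.2]
  · apply Continuous.integrableOn_Icc
    fun_prop
  · filter_upwards with t
    simp only [Pi.zero_apply]
    linarith [Real.cos_le_one (a * t)]

theorem lintegral_abs_coord_ge_le {n : ℕ} {W : Xi n → (Hn n →L[ℂ] Hn n)}
    (hW : IsWeylFamily n W) (w : Hn n) (j : Fin n) {δ : ℝ} (hδ : 0 < δ) {ε : ENNReal}
    (h : ∀ t ∈ Set.Icc (-δ) δ, ‖W (0, Pi.single j t) w - w‖ₑ ≤ ε) :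
    ∫⁻ y in {y | 2 / δ ≤ |y j|}, ‖w y‖ₑ ^ 2 ≤ ε ^ 2 := by
  have hm : Measurable w := (Lp.stronglyMeasurable w).measurable
  have key : ENNReal.ofReal (2 * δ) * ∫⁻ y in {y | 2 / δ ≤ |y j|}, ‖w y‖ₑ ^ 2
      ≤ ENNReal.ofReal (2 * δ) * ε ^ 2 := by
    calc _ = ∫⁻ y in {y | 2 / δ ≤ |y j|}, ENNReal.ofReal (2 * δ) * ‖w y‖ₑ ^ 2 := by
          rw [lintegral_const_mul]; fun_prop
      _ ≤ ∫⁻ y in {y | 2 / δ ≤ |y j|}, ∫⁻ t in Set.Icc (-δ) δ,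
            ‖Complex.exp (Complex.I * ((y j * t : ℝ) : ℂ)) - 1‖ₑ ^ 2 * ‖w y‖ₑ ^ 2 := by
          apply setLIntegral_mono' (measurableSet_le (by fun_prop) (by fun_prop))
          intro y hy
          rw [lintegral_mul_const _ (by fun_prop)]
          gcongr
          exact two_mul_le_lintegral_exp hδ hy
      _ ≤ ∫⁻ y, ∫⁻ t in Set.Icc (-δ) δ,
            ‖Complex.exp (Complex.I * ((y j * t : ℝ) : ℂ)) - 1‖ₑ ^ 2 * ‖w y‖ₑ ^ 2 :=
          setLIntegral_le_lintegral _ _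
      _ = ∫⁻ t in Set.Icc (-δ) δ, ∫⁻ y,
            ‖Complex.exp (Complex.I * ((y j * t : ℝ) : ℂ)) - 1‖ₑ ^ 2 * ‖w y‖ₑ ^ 2 := by
          rw [lintegral_lintegral_swap]
          fun_prop
      _ ≤ ∫⁻ t in Set.Icc (-δ) δ, ε ^ 2 := by
          apply setLIntegral_mono' measurableSet_Icc
          intro t ht
          refine le_trans (le_of_eq ?_) (pow_le_pow_left' (h t ht) 2)
          rw [enorm_sq_eq_lintegral]
          apply lintegral_congr_ae
          filter_upwards [hW 0 (Pi.single j t) w, Lp.coeFn_sub (W (0, Pi.single j t) w) w]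
            with y h1 h2
          rw [h2, Pi.sub_apply, h1]
          simp only [smul_zero, sub_zero, dotProduct_single]
          rw [← mul_pow, ← enorm_mul, sub_mul, one_mul]
      _ = _ := by
          rw [setLIntegral_const, Real.volume_Icc, mul_comm]
          congr 2; ring
  exact (ENNReal.mul_le_mul_iff_right (by simpa using hδ) ENNReal.ofReal_ne_top).1 key

theorem lintegral_ball_le {n : ℕ} {W : Xi n → (Hn n →L[ℂ] Hn n)}
    (hW : IsWeylFamily n W) (w : Hn n) {B : Set (Fin n → ℝ)} (hB : MeasurableSet B)
    {δ : ℝ} {ε η : ENNReal}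
    (h : ∀ x ∈ Metric.closedBall 0 δ, ‖W (x, 0) w - w‖ₑ ≤ ε)
    (hη : ∀ y ∈ B, ‖∫ z in Metric.closedBall y δ, w z‖ₑ ≤ η) :
    volume (Metric.closedBall (0 : Fin n → ℝ) δ) ^ 2 * ∫⁻ y in B, ‖w y‖ₑ ^ 2 ≤
      2 * (η ^ 2 * volume B + volume (Metric.closedBall (0 : Fin n → ℝ) δ) ^ 2 * ε ^ 2) := by
  have hm : Measurable w := (Lp.stronglyMeasurable w).measurable
  set Q := Metric.closedBall (0 : Fin n → ℝ) δ with hQ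
  have hvol : ∀ y : Fin n → ℝ, volume (Metric.closedBall y δ) = volume Q := fun y =>
    Measure.addHaar_closedBall_center _ _ _
  have hQt : volume Q ≠ ⊤ := measure_closedBall_lt_top.ne
  have hpt : ∀ y ∈ B, volume Q ^ 2 * ‖w y‖ₑ ^ 2 ≤
      2 * (η ^ 2 + volume Q * ∫⁻ x in Q, ‖w (y - x) - w y‖ₑ ^ 2) := by
    intro y hy
    have hint : IntegrableOn w (Metric.closedBall y δ) :=
      integrableOn_Lp_of_measure_ne_top w one_le_two measure_closedBall_lt_top.ne
    have h1 : volume Q * ‖w y‖ₑ ≤ η + ∫⁻ z in Metric.closedBall y δ, ‖w z - w y‖ₑ := by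
      have h2 : ((volume Q).toReal : ℂ) * w y = (∫ z in Metric.closedBall y δ, w z)
          - ∫ z in Metric.closedBall y δ, (w z - w y) := by
        rw [integral_sub hint (integrableOn_const measure_closedBall_lt_top.ne)]
        simp [Measure.real, hvol]
      have h3 : volume Q * ‖w y‖ₑ = ‖((volume Q).toReal : ℂ) * w y‖ₑ := by
        rw [enorm_mul]
        congr 1
        rw [← ofReal_norm, Complex.norm_real, Real.norm_of_nonneg ENNReal.toReal_nonneg,
          ENNReal.ofReal_toReal hQt]
      rw [h3, h2]
      refine enorm_sub_le.trans (add_le_add (hη y hy) (enorm_integral_le_lintegral_enorm _))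
    have h4 : (∫⁻ z in Metric.closedBall y δ, ‖w z - w y‖ₑ) ^ 2 ≤
        volume Q * ∫⁻ x in Q, ‖w (y - x) - w y‖ₑ ^ 2 := by
      refine (lintegral_sq_le_measure_mul _ (by fun_prop)).trans (le_of_eq ?_)
      rw [Measure.restrict_apply_univ, hvol]
      congr 1
      rw [← lintegral_indicator measurableSet_closedBall,
        ← lintegral_indicator measurableSet_closedBall,
        ← lintegral_sub_left_eq_self _ y]
      congr 1
      ext x
      simp [Set.indicator, dist_eq_norm]
    calc volume Q ^ 2 * ‖w y‖ₑ ^ 2 = (volume Q * ‖w y‖ₑ) ^ 2 := by rw [mul_pow]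
      _ ≤ (η + ∫⁻ z in Metric.closedBall y δ, ‖w z - w y‖ₑ) ^ 2 := by gcongr
      _ ≤ 2 * (η ^ 2 + (∫⁻ z in Metric.closedBall y δ, ‖w z - w y‖ₑ) ^ 2) := by
        have := ENNReal.rpow_add_le_mul_rpow_add_rpow η
          (∫⁻ z in Metric.closedBall y δ, ‖w z - w y‖ₑ) (p := 2) one_le_two
        norm_num at this
        exact_mod_cast this
      _ ≤ _ := by gcongr
  have hdiff : ∫⁻ y, ∫⁻ x in Q, ‖w (y - x) - w y‖ₑ ^ 2 ≤ volume Q * ε ^ 2 := by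
    rw [lintegral_lintegral_swap (by fun_prop)]
    calc _ ≤ ∫⁻ x in Q, ε ^ 2 := by
          apply setLIntegral_mono' measurableSet_closedBall
          intro x hx
          refine le_trans (le_of_eq ?_) (pow_le_pow_left' (h x hx) 2)
          rw [enorm_sq_eq_lintegral]
          apply lintegral_congr_ae
          filter_upwards [hW x 0 w, Lp.coeFn_sub (W (x, 0) w) w] with y h1 h2
          rw [h2, Pi.sub_apply, h1]
          simp
      _ = _ := by rw [setLIntegral_const, mul_comm]
  calc _ = ∫⁻ y in B, volume Q ^ 2 * ‖w y‖ₑ ^ 2 := by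
        rw [lintegral_const_mul]; fun_prop
    _ ≤ ∫⁻ y in B, 2 * (η ^ 2 + volume Q * ∫⁻ x in Q, ‖w (y - x) - w y‖ₑ ^ 2) :=
        setLIntegral_mono' hB hpt
    _ = 2 * (η ^ 2 * volume B + volume Q * ∫⁻ y in B, ∫⁻ x in Q, ‖w (y - x) - w y‖ₑ ^ 2) := by
        rw [lintegral_const_mul' _ _ (by simp), lintegral_add_left (by fun_prop), setLIntegral_const,
          lintegral_const_mul' _ _ hQt]
    _ ≤ 2 * (η ^ 2 * volume B + volume Q * (volume Q * ε ^ 2)) := by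
        gcongr
        exact (setLIntegral_le_lintegral _ _).trans hdiff
    _ = _ := by rw [sq (volume Q), mul_assoc]

theorem eventually_forall_norm_inner_le {E ι : Type*} [NormedAddCommGroup E]
    [InnerProductSpace ℂ E] {w : ι → E} {F : Filter ι} {M : ℝ} (hM : ∀ i, ‖w i‖ ≤ M)
    (hw : ∀ φ : E, Tendsto (fun i => inner ℂ φ (w i)) F (𝓝 0)) {K : Set E} (hK : IsCompact K)
    {η : ℝ} (hη : 0 < η) : ∀ᶠ i in F, ∀ φ ∈ K, ‖inner ℂ φ (w i)‖ ≤ η := by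
  obtain ⟨t, -, htf, ht⟩ := hK.finite_cover_balls (e := η / 2 / (|M| + 1)) (by positivity)
  have h1 : ∀ᶠ i in F, ∀ φ ∈ t, ‖inner ℂ φ (w i)‖ < η / 2 :=
    (eventually_all_finite htf).2 fun φ _ =>
      (NormedAddGroup.tendsto_nhds_zero.1 (hw φ)) _ (by positivity)
  filter_upwards [h1] with i hi φ hφ
  obtain ⟨ψ, hψ, hd⟩ := Set.mem_iUnion₂.1 (ht hφ)
  rw [Metric.mem_ball, dist_eq_norm] at hd
  have h2 : inner ℂ φ (w i) = inner ℂ ψ (w i) + inner ℂ (φ - ψ) (w i) := by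
    rw [inner_sub_left]; ring
  have h3 : ‖inner ℂ (φ - ψ) (w i)‖ ≤ η / 2 := by
    refine (norm_inner_le_norm _ _).trans ?_
    calc _ ≤ η / 2 / (|M| + 1) * (|M| + 1) := by
          gcongr
          linarith [hM i, le_abs_self M]
      _ = η / 2 := by field_simp
  rw [h2]
  linarith [norm_add_le (inner ℂ ψ (w i)) (inner ℂ (φ - ψ) (w i)), hi ψ hψ]

/-- Translation by `x` on `L²(ℝⁿ)`. -/
def translateLp {n : ℕ} (x : Fin n → ℝ) (u : Hn n) : Hn n := DomAddAct.mk (-x) +ᵥ u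

theorem continuous_translateLp {n : ℕ} (u : Hn n) : Continuous fun x => translateLp x u :=
  haveI : Fact ((2 : ENNReal) ≠ ⊤) := ⟨by simp⟩
  continuous_vadd.comp
    ((DomAddAct.continuous_mk.comp continuous_neg).prodMk continuous_const)

theorem translateLp_zero {n : ℕ} (u : Hn n) : translateLp 0 u = u := by
  simp [translateLp]

theorem translateLp_ae_eq {n : ℕ} (x : Fin n → ℝ) (u : Hn n) :
    translateLp x u =ᵐ[volume] fun y => u (y - x) := by
  filter_upwards [DomAddAct.vadd_Lp_ae_eq (DomAddAct.mk (-x)) u] with y hy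
  rw [translateLp, hy]
  simp [sub_eq_neg_add]

theorem inner_translateLp_indicatorConstLp {n : ℕ} (y : Fin n → ℝ) (δ : ℝ) (w : Hn n) :
    inner ℂ (translateLp y (indicatorConstLp 2 (measurableSet_closedBall (x := 0) (ε := δ))
      measure_closedBall_lt_top.ne (1 : ℂ))) w = ∫ z in Metric.closedBall y δ, w z := by
  rw [translateLp, DomAddAct.mk_vadd_indicatorConstLp, L2.inner_indicatorConstLp_one]
  congr 2
  ext z
  simp [dist_eq_norm, sub_eq_neg_add]

theorem tendsto_zero_of_weak_of_equicontinuous {n : ℕ} {W : Xi n → (Hn n →L[ℂ] Hn n)}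
    (hW : IsWeylFamily n W) {ι : Type*} {w : ι → Hn n} {F : Filter ι} {M : ℝ}
    (hM : ∀ i, ‖w i‖ ≤ M) (hw : ∀ φ : Hn n, Tendsto (fun i => inner ℂ φ (w i)) F (𝓝 0))
    (heq : ∀ ε > 0, ∀ᶠ Z in 𝓝 (0 : Xi n), ∀ i, ‖W Z (w i) - w i‖ ≤ ε) :
    Tendsto w F (𝓝 0) := by
  rw [NormedAddGroup.tendsto_nhds_zero]
  intro r hr
  set ε : ℝ := r / (5 + n) with hε
  have hε0 : 0 < ε := by positivity
  obtain ⟨δ, hδ, hδε⟩ := Metric.nhds_basis_closedBall.eventually_iff.1 (heq ε hε0)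
  have hen : ∀ Z : Xi n, ‖Z‖ ≤ δ → ∀ i, ‖W Z (w i) - w i‖ₑ ≤ ENNReal.ofReal ε := by
    intro Z hZ i
    rw [← ofReal_norm]
    exact ENNReal.ofReal_le_ofReal (hδε (by simpa using hZ) i)
  set B : Set (Fin n → ℝ) := Metric.closedBall 0 (2 / δ) with hB
  have hBc : Bᶜ ⊆ ⋃ j, {y | 2 / δ ≤ |y j|} := by
    intro y hy
    by_contra hcon
    simp only [Set.mem_iUnion, Set.mem_ofPred_eq, not_exists, not_le] at hcon
    apply hy
    rw [hB, mem_closedBall_zero_iff, pi_norm_le_iff_of_nonneg (by positivity)]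
    exact fun j => (hcon j).le
  set V := volume (Metric.closedBall (0 : Fin n → ℝ) δ) with hV
  have hV0 : V ≠ 0 := (Metric.measure_closedBall_pos _ _ hδ).ne'
  have hVt : V ≠ ⊤ := measure_closedBall_lt_top.ne
  have hBt : volume B ≠ ⊤ := measure_closedBall_lt_top.ne
  set v := V.toReal with hv
  have hv0 : 0 < v := ENNReal.toReal_pos hV0 hVt
  set b := (volume B).toReal with hb
  have hb0 : 0 ≤ b := ENNReal.toReal_nonneg
  set η : ℝ := v * ε / (b + 1) with hη
  have hη0 : 0 < η := by positivity
  have hηb : η ^ 2 * b ≤ v ^ 2 * ε ^ 2 := by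
    rw [hη, div_pow, mul_pow, div_mul_eq_mul_div, div_le_iff₀ (by positivity)]
    gcongr
    nlinarith
  have hK : IsCompact ((fun y => translateLp y (indicatorConstLp 2
      (measurableSet_closedBall (x := (0 : Fin n → ℝ)) (ε := δ))
      measure_closedBall_lt_top.ne (1 : ℂ))) '' B) :=
    (isCompact_closedBall _ _).image (continuous_translateLp _)
  filter_upwards [eventually_forall_norm_inner_le hM hw hK hη0] with i hi
  have h1 : V ^ 2 * ∫⁻ y in B, ‖w i y‖ₑ ^ 2 ≤
      2 * (ENNReal.ofReal η ^ 2 * volume B + V ^ 2 * ENNReal.ofReal ε ^ 2) := by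
    refine lintegral_ball_le hW (w i) measurableSet_closedBall (fun x hx => hen _ ?_ i) ?_
    · simpa using hx
    · intro y hy
      have := hi _ (Set.mem_image_of_mem _ hy)
      rw [inner_translateLp_indicatorConstLp] at this
      rw [← ofReal_norm]
      exact ENNReal.ofReal_le_ofReal this
  have h2 : ∫⁻ y in Bᶜ, ‖w i y‖ₑ ^ 2 ≤ n * ENNReal.ofReal ε ^ 2 := by
    calc _ ≤ ∫⁻ y in ⋃ j, {y : Fin n → ℝ | 2 / δ ≤ |y j|}, ‖w i y‖ₑ ^ 2 :=
          lintegral_mono_set hBc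
      _ ≤ ∑' j, ∫⁻ y in {y : Fin n → ℝ | 2 / δ ≤ |y j|}, ‖w i y‖ₑ ^ 2 :=
          lintegral_iUnion_le _ _
      _ ≤ ∑' j : Fin n, ENNReal.ofReal ε ^ 2 := by
          gcongr with j
          refine lintegral_abs_coord_ge_le hW (w i) j hδ fun t ht => hen _ ?_ i
          simpa [Prod.norm_def, Pi.norm_single, abs_le, hδ.le] using ht
      _ = _ := by simp [tsum_fintype]
  have h3 : V ^ 2 * ‖w i‖ₑ ^ 2 ≤
      2 * (ENNReal.ofReal η ^ 2 * volume B + V ^ 2 * ENNReal.ofReal ε ^ 2) +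
        V ^ 2 * (n * ENNReal.ofReal ε ^ 2) := by
    rw [enorm_sq_eq_lintegral, ← lintegral_add_compl _ (measurableSet_closedBall : MeasurableSet B),
      mul_add]
    gcongr
  have h4 : v ^ 2 * ‖w i‖ ^ 2 ≤ 2 * (η ^ 2 * b + v ^ 2 * ε ^ 2) + v ^ 2 * (n * ε ^ 2) := by
    have h5 := ENNReal.toReal_mono (by finiteness) h3
    rw [ENNReal.toReal_add (by finiteness) (by finiteness), ENNReal.toReal_mul (a := 2),
      ENNReal.toReal_add (by finiteness) (by finiteness)] at h5
    simpa [ENNReal.toReal_ofReal, hη0.le, hε0.le, ← hv, ← hb] using h5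
  have h5 : ‖w i‖ ^ 2 ≤ (4 + n) * ε ^ 2 := by
    have : v ^ 2 * ‖w i‖ ^ 2 ≤ v ^ 2 * ((4 + n) * ε ^ 2) := by nlinarith
    exact le_of_mul_le_mul_left this (by positivity)
  have h6 : (4 + n) * ε ^ 2 < r ^ 2 := by
    have hr' : r = (5 + n) * ε := by rw [hε]; field_simp
    have hn : (0 : ℝ) ≤ n := n.cast_nonneg
    have : (4 + n : ℝ) < (5 + n) ^ 2 := by nlinarith
    rw [hr', mul_pow]
    gcongr
  exact lt_of_pow_lt_pow_left₀ 2 hr.le (h5.trans_lt h6)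

theorem IsWeylFamily.tendsto_nhds_zero {n : ℕ} {W : Xi n → (Hn n →L[ℂ] Hn n)}
    (hW : IsWeylFamily n W) (u : Hn n) : Tendsto (fun Z => W Z u) (𝓝 0) (𝓝 u) := by
  have hm : Measurable u := (Lp.stronglyMeasurable u).measurable
  have hbound : ∀ Z : Xi n, ‖W Z u - u‖ₑ ^ 2 ≤ 2 * (‖translateLp Z.1 u - u‖ₑ ^ 2 +
      ∫⁻ y, ‖Complex.exp (Complex.I * (((y - (2⁻¹ : ℝ) • Z.1) ⬝ᵥ Z.2 : ℝ) : ℂ)) - 1‖ₑ ^ 2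
        * ‖u y‖ₑ ^ 2) := by
    rintro ⟨x, ξ⟩
    rw [enorm_sq_eq_lintegral, enorm_sq_eq_lintegral, ← lintegral_add_left (by
      have := (Lp.stronglyMeasurable (translateLp x u - u)).measurable
      fun_prop), ← lintegral_const_mul' _ _ (by simp)]
    apply lintegral_mono_ae
    filter_upwards [hW x ξ u, Lp.coeFn_sub (W (x, ξ) u) u, Lp.coeFn_sub (translateLp x u) u,
      translateLp_ae_eq x u] with y h1 h2 h3 h4
    rw [h2, h3, Pi.sub_apply, Pi.sub_apply, h1, h4]
    set s := (y - (2⁻¹ : ℝ) • x) ⬝ᵥ ξ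
    have h5 : Complex.exp (Complex.I * (s : ℂ)) * u (y - x) - u y =
        Complex.exp (Complex.I * (s : ℂ)) * (u (y - x) - u y) +
          (Complex.exp (Complex.I * (s : ℂ)) - 1) * u y := by ring
    have h6 : ‖Complex.exp (Complex.I * (s : ℂ))‖ₑ = 1 := by
      rw [← ofReal_norm, mul_comm, Complex.norm_exp_ofReal_mul_I, ENNReal.ofReal_one]
    rw [h5]
    refine (pow_le_pow_left' (enorm_add_le _ _) 2).trans ?_
    rw [enorm_mul, enorm_mul, h6, one_mul, ← mul_pow]
    have := ENNReal.rpow_add_le_mul_rpow_add_rpow ‖u (y - x) - u y‖ₑ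
      (‖Complex.exp (Complex.I * (s : ℂ)) - 1‖ₑ * ‖u y‖ₑ) (p := 2) one_le_two
    norm_num at this
    exact_mod_cast this
  have ht1 : Tendsto (fun Z : Xi n => ‖translateLp Z.1 u - u‖ₑ ^ 2) (𝓝 0) (𝓝 0) := by
    have hc : Continuous fun Z : Xi n => ‖translateLp Z.1 u - u‖ₑ :=
      (((continuous_translateLp u).comp continuous_fst).sub continuous_const).enorm
    have h := (ENNReal.continuous_pow 2).tendsto _ |>.comp (hc.tendsto 0)
    simpa [Function.comp_def, translateLp_zero] using h
  have ht2 : Tendsto (fun Z : Xi n => ∫⁻ y,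
      ‖Complex.exp (Complex.I * (((y - (2⁻¹ : ℝ) • Z.1) ⬝ᵥ Z.2 : ℝ) : ℂ)) - 1‖ₑ ^ 2
        * ‖u y‖ₑ ^ 2) (𝓝 0) (𝓝 0) := by
    have h := tendsto_lintegral_filter_of_dominated_convergence (μ := volume) (l := 𝓝 (0 : Xi n))
      (F := fun (Z : Xi n) y =>
        ‖Complex.exp (Complex.I * (((y - (2⁻¹ : ℝ) • Z.1) ⬝ᵥ Z.2 : ℝ) : ℂ)) - 1‖ₑ ^ 2
          * ‖u y‖ₑ ^ 2) (f := fun _ => 0) (fun y => 4 * ‖u y‖ₑ ^ 2) ?_ ?_ ?_ ?_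
    · simpa using h
    · refine Eventually.of_forall fun Z => ?_
      have : Continuous fun y : Fin n → ℝ => (y - (2⁻¹ : ℝ) • Z.1) ⬝ᵥ Z.2 := by fun_prop
      have := this.measurable
      fun_prop
    · refine Eventually.of_forall fun Z => Eventually.of_forall fun y => ?_
      gcongr
      rw [enorm_exp_I_mul_sub_one_sq, ← ENNReal.ofReal_ofNat]
      apply ENNReal.ofReal_le_ofReal
      linarith [Real.neg_one_le_cos ((y - (2⁻¹ : ℝ) • Z.1) ⬝ᵥ Z.2)]
    · rw [lintegral_const_mul' _ _ (by simp), ← enorm_sq_eq_lintegral]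
      finiteness
    · refine Eventually.of_forall fun y => ?_
      have hc : Continuous fun Z : Xi n =>
          ‖Complex.exp (Complex.I * (((y - (2⁻¹ : ℝ) • Z.1) ⬝ᵥ Z.2 : ℝ) : ℂ)) - 1‖ₑ ^ 2 := by
        simp_rw [enorm_exp_I_mul_sub_one_sq]
        exact ENNReal.continuous_ofReal.comp (by fun_prop)
      have h1 := ENNReal.Tendsto.mul_const (b := ‖u y‖ₑ ^ 2) (hc.tendsto 0)
        (Or.inr (by finiteness))
      simpa using h1
  have ht3 : Tendsto (fun Z : Xi n => ‖W Z u - u‖ₑ ^ 2) (𝓝 0) (𝓝 0) := by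
    refine tendsto_of_tendsto_of_tendsto_of_le_of_le tendsto_const_nhds ?_ (fun _ => zero_le)
      hbound
    simpa using ENNReal.Tendsto.const_mul (a := 2) (ht1.add ht2) (Or.inr (by simp))
  have ht4 : Tendsto (fun Z : Xi n => ‖W Z u - u‖ ^ 2) (𝓝 0) (𝓝 0) := by
    have := (ENNReal.tendsto_toReal ENNReal.zero_ne_top).comp ht3
    simpa [Function.comp_def] using this
  rw [tendsto_iff_norm_sub_tendsto_zero]
  have := (Real.continuous_sqrt.tendsto 0).comp ht4
  simpa [Function.comp_def, Real.sqrt_sq] using this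

theorem exists_tendsto_inner_sub {E ι : Type*} [NormedAddCommGroup E] [InnerProductSpace ℂ E]
    [CompleteSpace E] {v : ι → E} {M : ℝ} (hM : ∀ i, ‖v i‖ ≤ M) (U : Ultrafilter ι) :
    ∃ a : E, ∀ φ : E, Tendsto (fun i => inner ℂ φ (v i - a)) U (𝓝 0) := by
  set g : ι → WeakDual ℂ E := fun i =>
    StrongDual.toWeakDual (InnerProductSpace.toDual ℂ E (v i)) with hg
  have hc := WeakDual.isCompact_closedBall (𝕜 := ℂ) (E := E) 0 M
  obtain ⟨f, -, hf⟩ := hc.ultrafilter_le_nhds (U.map g) (by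
    rw [le_principal_iff, Ultrafilter.mem_coe, Ultrafilter.mem_map]
    refine univ_mem' fun i => ?_
    simp only [Set.mem_preimage, hg, Metric.mem_closedBall, dist_zero_right]
    have : WeakDual.toStrongDual (StrongDual.toWeakDual (InnerProductSpace.toDual ℂ E (v i)))
      = InnerProductSpace.toDual ℂ E (v i) := rfl
    rw [this]
    simpa using hM i)
  refine ⟨(InnerProductSpace.toDual ℂ E).symm (WeakDual.toStrongDual f), fun φ => ?_⟩
  have h1 : Tendsto (fun i => g i φ) U (𝓝 (f φ)) :=
    ((WeakDual.eval_continuous φ).tendsto f).comp hf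
  have h2 : Tendsto (fun i => inner ℂ (v i) φ - f φ) U (𝓝 0) := by
    simpa [hg] using h1.sub_const (f φ)
  have h3 := (Complex.continuous_conj.tendsto 0).comp h2
  rw [map_zero] at h3
  refine h3.congr fun i => ?_
  rw [Function.comp_apply, map_sub, inner_sub_right, inner_conj_symm,
    ← inner_conj_symm φ ((InnerProductSpace.toDual ℂ E).symm _), InnerProductSpace.toDual_symm_apply]
  rfl

theorem exists_tendsto_of_equicontinuous {n : ℕ} {W : Xi n → (Hn n →L[ℂ] Hn n)}
    (hW : IsWeylFamily n W) {ι : Type*} {v : ι → Hn n} {M : ℝ} (hM : ∀ i, ‖v i‖ ≤ M)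
    (heq : ∀ ε > 0, ∀ᶠ Z in 𝓝 (0 : Xi n), ∀ i, ‖W Z (v i) - v i‖ ≤ ε) (U : Ultrafilter ι) :
    ∃ a, Tendsto v U (𝓝 a) := by
  obtain ⟨a, ha⟩ := exists_tendsto_inner_sub hM U
  refine ⟨a, tendsto_sub_nhds_zero_iff.1 <|
    tendsto_zero_of_weak_of_equicontinuous hW (M := M + ‖a‖) (fun i => ?_) ha fun ε hε => ?_⟩
  · exact (norm_sub_le _ _).trans (by gcongr; exact hM i)
  · have h1 := (tendsto_iff_norm_sub_tendsto_zero.1 (hW.tendsto_nhds_zero a)).eventually_le_const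
      (half_pos hε)
    filter_upwards [heq (ε / 2) (half_pos hε), h1] with Z h2 h3 i
    have h4 : W Z (v i - a) - (v i - a) = (W Z (v i) - v i) - (W Z a - a) := by
      rw [map_sub]; abel
    rw [h4]
    linarith [norm_sub_le (W Z (v i) - v i) (W Z a - a), h2 i]

theorem IsWeylFamily.map_zero {n : ℕ} {W : Xi n → (Hn n →L[ℂ] Hn n)}
    (hW : IsWeylFamily n W) : W 0 = 1 := by
  ext u : 1
  apply Lp.ext
  filter_upwards [hW 0 0 u] with y hy
  rw [show (0 : Xi n) = (0, 0) from rfl, hy]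
  simp

theorem IsWeylFamily.exists_mul_eq_smul {n : ℕ} {W : Xi n → (Hn n →L[ℂ] Hn n)}
    (hW : IsWeylFamily n W) (X Z : Xi n) :
    ∃ c : ℂ, ‖c‖ = 1 ∧ W Z * W X = c • (W X * W Z) := by
  obtain ⟨x, ξ⟩ := X
  obtain ⟨z, ζ⟩ := Z
  refine ⟨Complex.exp (((x ⬝ᵥ ζ - z ⬝ᵥ ξ : ℝ) : ℂ) * Complex.I),
    Complex.norm_exp_ofReal_mul_I _, ?_⟩
  ext u : 1
  apply Lp.ext
  have h1 := (measurePreserving_sub_right volume z).quasiMeasurePreserving.ae (hW x ξ u)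
  have h2 := (measurePreserving_sub_right volume x).quasiMeasurePreserving.ae (hW z ζ u)
  filter_upwards [h1, h2, hW z ζ (W (x, ξ) u), hW x ξ (W (z, ζ) u),
    Lp.coeFn_smul (Complex.exp (((x ⬝ᵥ ζ - z ⬝ᵥ ξ : ℝ) : ℂ) * Complex.I))
      ((W (x, ξ) * W (z, ζ)) u)] with y h1 h2 h3 h4 h5
  have hmul : ∀ A B : Hn n →L[ℂ] Hn n, (A * B) u = A (B u) := fun _ _ => rfl
  rw [_root_.smul_apply, h5, Pi.smul_apply, hmul, hmul, h3, h4, h1, h2, smul_eq_mul, ← mul_assoc, ← mul_assoc, ← mul_assoc,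
    ← Complex.exp_add, ← Complex.exp_add, ← Complex.exp_add, sub_right_comm y z x]
  congr 2
  simp only [sub_dotProduct, smul_dotProduct]
  push_cast
  ring

theorem IsWeylFamily.tconj_comm {n : ℕ} {W : Xi n → (Hn n →L[ℂ] Hn n)}
    (hW : IsWeylFamily n W) (X Z : Xi n) (S : Hn n →L[ℂ] Hn n) :
    Tconj n W Z (Tconj n W X S) = Tconj n W X (Tconj n W Z S) := by
  obtain ⟨c, hc, h⟩ := hW.exists_mul_eq_smul X Z
  have h1 : ∀ A B : Xi n, Tconj n W A (Tconj n W B S) = (W A * W B) * S * star (W A * W B) := by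
    intro A B
    simp only [Tconj, star_mul, mul_assoc]
  have hcc : c * star c = 1 := by
    rw [Complex.star_def, Complex.mul_conj, Complex.normSq_eq_norm_sq, hc]; simp
  rw [h1, h1, h, star_smul, smul_mul_assoc, smul_mul_assoc, mul_smul_comm, smul_smul, hcc, one_smul]

theorem norm_tconj {n : ℕ} {W : Xi n → (Hn n →L[ℂ] Hn n)}
    (hWU : ∀ X : Xi n, W X ∈ unitary (Hn n →L[ℂ] Hn n)) (X : Xi n) (S : Hn n →L[ℂ] Hn n) :
    ‖Tconj n W X S‖ = ‖S‖ := by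
  rw [Tconj, CStarRing.norm_mul_mem_unitary _ (Unitary.star_mem (hWU X)),
    CStarRing.norm_mem_unitary_mul _ (hWU X)]

theorem tconj_sub {n : ℕ} (W : Xi n → (Hn n →L[ℂ] Hn n)) (X : Xi n) (S T : Hn n →L[ℂ] Hn n) :
    Tconj n W X (S - T) = Tconj n W X S - Tconj n W X T := by
  simp only [Tconj, mul_sub, sub_mul]

theorem star_tconj {n : ℕ} (W : Xi n → (Hn n →L[ℂ] Hn n)) (X : Xi n) (S : Hn n →L[ℂ] Hn n) :
    star (Tconj n W X S) = Tconj n W X (star S) := by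
  simp only [Tconj, star_mul, star_star, mul_assoc]

theorem star_mem_B0 {n : ℕ} {W : Xi n → (Hn n →L[ℂ] Hn n)} {S : Hn n →L[ℂ] Hn n}
    (hS : S ∈ B0 n W) : star S ∈ B0 n W := by
  have : Continuous fun X => star (Tconj n W X S) := Continuous.star hS
  simp only [star_tconj] at this
  exact this

theorem exists_tendsto_tconj_apply {n : ℕ} {W : Xi n → (Hn n →L[ℂ] Hn n)}
    (hW : IsWeylFamily n W) (hWU : ∀ X : Xi n, W X ∈ unitary (Hn n →L[ℂ] Hn n))
    {S : Hn n →L[ℂ] Hn n} (hS : S ∈ B0 n W) (U : Ultrafilter (Xi n)) (u : Hn n) :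
    ∃ a, Tendsto (fun X => Tconj n W X S u) U (𝓝 a) := by
  have hb : ∀ (X : Xi n) (T : Hn n →L[ℂ] Hn n) (v : Hn n), ‖Tconj n W X T v‖ ≤ ‖T‖ * ‖v‖ :=
    fun X T v => (ContinuousLinearMap.le_opNorm _ _).trans_eq (by rw [norm_tconj hWU])
  refine exists_tendsto_of_equicontinuous hW (M := ‖S‖ * ‖u‖) (fun X => hb X S u)
    (fun ε hε => ?_) U
  have h1 : Tendsto (fun Z => Tconj n W Z S - S) (𝓝 0) (𝓝 0) := by
    have h0 : Tconj n W 0 S = S := by simp [Tconj, hW.map_zero]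
    have := (Continuous.tendsto hS 0).sub_const S
    simpa [h0] using this
  have h2 : Tendsto (fun Z => ‖Tconj n W Z S - S‖ * ‖W Z u‖ + ‖S‖ * ‖W Z u - u‖) (𝓝 0) (𝓝 0) := by
    have h3 := hW.tendsto_nhds_zero u
    simpa using (h1.norm.mul h3.norm).add ((h3.sub_const u).norm.const_mul ‖S‖)
  filter_upwards [h2.eventually_le_const hε] with Z hZ X
  have h4 : W Z (Tconj n W X S u) = Tconj n W X (Tconj n W Z S) (W Z u) := by
    have h5 : W Z * Tconj n W X S = Tconj n W X (Tconj n W Z S) * W Z := by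
      rw [← hW.tconj_comm, Tconj.eq_1 n W Z, mul_assoc _ (star (W Z)), Unitary.star_mul_self_of_mem (hWU Z),
        mul_one]
    exact congrArg (fun T : Hn n →L[ℂ] Hn n => T u) h5
  have h6 : W Z (Tconj n W X S u) - Tconj n W X S u =
      Tconj n W X (Tconj n W Z S - S) (W Z u) + Tconj n W X S (W Z u - u) := by
    rw [h4, tconj_sub, _root_.sub_apply, map_sub]
    abel
  rw [h6]
  exact (norm_add_le _ _).trans ((add_le_add (hb _ _ _) (hb _ _ _)).trans hZ)

theorem exists_clm_tendsto_tconj {n : ℕ} {W : Xi n → (Hn n →L[ℂ] Hn n)}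
    (hW : IsWeylFamily n W) (hWU : ∀ X : Xi n, W X ∈ unitary (Hn n →L[ℂ] Hn n))
    {S : Hn n →L[ℂ] Hn n} (hS : S ∈ B0 n W) (U : Ultrafilter (Xi n)) :
    ∃ T : Hn n →L[ℂ] Hn n, ∀ u, Tendsto (fun X => Tconj n W X S u) U (𝓝 (T u)) := by
  choose f hf using exists_tendsto_tconj_apply hW hWU hS U
  refine ⟨LinearMap.mkContinuous ⟨⟨f, fun u v => ?_⟩, fun c u => ?_⟩ ‖S‖ fun u => ?_, hf⟩
  · exact tendsto_nhds_unique (hf (u + v)) (by simpa using (hf u).add (hf v))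
  · exact tendsto_nhds_unique (hf (c • u)) (by simpa using (hf u).const_smul c)
  · refine le_of_tendsto (hf u).norm (Eventually.of_forall fun X => ?_)
    exact (ContinuousLinearMap.le_opNorm _ _).trans_eq (by rw [norm_tconj hWU])

theorem mem_B0_of_tendsto_tconj {n : ℕ} {W : Xi n → (Hn n →L[ℂ] Hn n)}
    (hW : IsWeylFamily n W) (hWU : ∀ X : Xi n, W X ∈ unitary (Hn n →L[ℂ] Hn n))
    {S T : Hn n →L[ℂ] Hn n} (hS : S ∈ B0 n W) {F : Filter (Xi n)} [F.NeBot]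
    (hT : ∀ u, Tendsto (fun X => Tconj n W X S u) F (𝓝 (T u))) : T ∈ B0 n W := by
  have h1 : ∀ Z u, Tendsto (fun X => Tconj n W X (Tconj n W Z S) u) F (𝓝 (Tconj n W Z T u)) := by
    intro Z u
    simp_rw [← hW.tconj_comm]
    exact ((W Z).continuous.tendsto _).comp (hT (star (W Z) u))
  have h2 : ∀ Y Z, ‖Tconj n W Y T - Tconj n W Z T‖ ≤ ‖Tconj n W Y S - Tconj n W Z S‖ := by
    intro Y Z
    refine ContinuousLinearMap.opNorm_le_bound _ (norm_nonneg _) fun u => ?_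
    refine le_of_tendsto ((h1 Y u).sub (h1 Z u)).norm (Eventually.of_forall fun X => ?_)
    rw [← _root_.sub_apply, ← tconj_sub]
    exact (ContinuousLinearMap.le_opNorm _ _).trans_eq (by rw [norm_tconj hWU])
  refine continuous_iff_continuousAt.2 fun Z => ?_
  rw [ContinuousAt, tendsto_iff_norm_sub_tendsto_zero]
  exact squeeze_zero (fun _ => norm_nonneg _) (fun Y => h2 Y Z)
    (tendsto_iff_norm_sub_tendsto_zero.1 (Continuous.tendsto hS Z))

/-- for `S ∈ B⁰(H)` and any ultrafilter `U` on `Ξ`, the limit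
`T_U(S)` of `T_X(S)` along `U` exists in the *-strong topology and lies in
`B⁰(H)`. -/
theorem statement5 (n : ℕ) (W : Xi n → (Hn n →L[ℂ] Hn n))
    (hW : IsWeylFamily n W) (hWU : ∀ X : Xi n, W X ∈ unitary (Hn n →L[ℂ] Hn n))
    (S : Hn n →L[ℂ] Hn n) (hS : S ∈ B0 n W) (U : Ultrafilter (Xi n)) :
    ∃ TU ∈ B0 n W, ∀ u : Hn n,
      Tendsto (fun X : Xi n => Tconj n W X S u) (U : Filter (Xi n)) (𝓝 (TU u)) ∧
      Tendsto (fun X : Xi n => star (Tconj n W X S) u) (U : Filter (Xi n))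
        (𝓝 (star TU u)) := by
  obtain ⟨T, hT⟩ := exists_clm_tendsto_tconj hW hWU hS U
  obtain ⟨R, hR⟩ := exists_clm_tendsto_tconj hW hWU (star_mem_B0 hS) U
  have hRT : star T = R := by
    rw [ContinuousLinearMap.star_eq_adjoint]
    refine ((ContinuousLinearMap.eq_adjoint_iff R T).2 fun u v => ?_).symm
    refine tendsto_nhds_unique ((hR u).inner tendsto_const_nhds) ?_
    refine (tendsto_const_nhds.inner (hT v)).congr fun X => ?_
    rw [← star_tconj, ContinuousLinearMap.star_eq_adjoint, ContinuousLinearMap.adjoint_inner_left]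
  refine ⟨T, mem_B0_of_tendsto_tconj hW hWU hS hT, fun u => ⟨hT u, ?_⟩⟩
  simp_rw [hRT, star_tconj]
  exact hR u
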